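/- arXiv:1503.00998 — 3 statements merged into one kernel-verified Lean document; each statement's English description precedes it below -/
import Mathlib

section
/- If G is an r-regular graph on n vertices (r ≥ 1), 𝓛 a coloring condition over finite color set K, and λ: K → (0,∞) an activation function, then the total weight of all 𝓛-legal neighborhood colorings of G, where the weight of a coloring φ is ∏_{v ∈ V(G)} λ(φ(v)), is at most N^λ(r,𝓛)^(n/r), where N^λ(r,𝓛) = Σ_{f:[r]→K, f([r])∈𝓛} ∏_{i∈[r]} λ(f(i)). -/
/-- Hölder's inequality for `r` functions, with all exponents equal to `r`, on a finite type
with nonnegative weights. -/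
theorem sum_mul_prod_rpow_le {ι K : Type*} [Fintype K] (s : Finset ι) (r : ℕ) (hr : 1 ≤ r)
    (hs : s.card = r) (p : K → ℝ) (hp : ∀ k, 0 ≤ p k) (g : ι → K → ℝ) (hg : ∀ i k, 0 ≤ g i k) :
    ∑ k, p k * ∏ i ∈ s, g i k ^ (1 / r : ℝ) ≤ ∏ i ∈ s, (∑ k, p k * g i k) ^ (1 / r : ℝ) := by
  have hr0 : (0 : ℝ) < r := by exact_mod_cast hr
  have hne : (1 / r : ℝ) ≠ 0 := by positivity
  have hG : ∀ i, 0 ≤ ∑ k, p k * g i k := fun i =>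
    Finset.sum_nonneg fun k _ => mul_nonneg (hp k) (hg i k)
  by_cases h0 : ∃ i ∈ s, ∑ k, p k * g i k = 0
  · obtain ⟨i, his, hi⟩ := h0
    rw [Finset.sum_eq_zero_iff_of_nonneg fun k _ => mul_nonneg (hp k) (hg i k)] at hi
    refine (Finset.sum_eq_zero fun k hk => ?_).trans_le
      (Finset.prod_nonneg fun i _ => Real.rpow_nonneg (hG i) _)
    rcases mul_eq_zero.1 (hi k hk) with h | h
    · rw [h, zero_mul]
    · rw [Finset.prod_eq_zero his (by rw [h, Real.zero_rpow hne]), mul_zero]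
  · push Not at h0
    have hpos : ∀ i ∈ s, 0 < ∑ k, p k * g i k := fun i hi => (hG i).lt_of_ne' (h0 i hi)
    have hP : 0 < ∏ i ∈ s, (∑ k, p k * g i k) ^ (1 / r : ℝ) :=
      Finset.prod_pos fun i hi => Real.rpow_pos_of_pos (hpos i hi) _
    rw [← div_le_one hP, Finset.sum_div]
    calc ∑ k, (p k * ∏ i ∈ s, g i k ^ (1 / r : ℝ)) /
          ∏ i ∈ s, (∑ k, p k * g i k) ^ (1 / r : ℝ)
        = ∑ k, p k * ∏ i ∈ s, (g i k / ∑ k, p k * g i k) ^ (1 / r : ℝ) := by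
          refine Finset.sum_congr rfl fun k _ => ?_
          rw [mul_div_assoc, ← Finset.prod_div_distrib]
          congr 1
          exact Finset.prod_congr rfl fun i _ => (Real.div_rpow (hg i k) (hG i) _).symm
      _ ≤ ∑ k, p k * ∑ i ∈ s, (1 / r : ℝ) * (g i k / ∑ k, p k * g i k) := by
          refine Finset.sum_le_sum fun k _ => mul_le_mul_of_nonneg_left ?_ (hp k)
          refine Real.geom_mean_le_arith_mean_weighted s (fun _ => (1 / r : ℝ)) _
            (fun _ _ => by positivity) ?_ fun i _ => div_nonneg (hg i k) (hG i)
          rw [Finset.sum_const, hs, nsmul_eq_mul, mul_one_div_cancel hr0.ne']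
      _ = ∑ i ∈ s, (1 / r : ℝ) * ((∑ k, p k * g i k) / ∑ k, p k * g i k) := by
          simp_rw [Finset.mul_sum, Finset.sum_div]
          rw [Finset.sum_comm]
          refine Finset.sum_congr rfl fun i _ => ?_
          rw [Finset.mul_sum]
          exact Finset.sum_congr rfl fun k _ => by ring
      _ = ∑ i ∈ s, (1 / r : ℝ) :=
          Finset.sum_congr rfl fun i hi => by rw [div_self (hpos i hi).ne', mul_one]
      _ = 1 := by rw [Finset.sum_const, hs, nsmul_eq_mul, mul_one_div_cancel hr0.ne']

theorem Fin.sum_prod_mul_eq_sum_cons {K : Type*} [Fintype K] (n : ℕ) (p : K → ℝ)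
    (F : (Fin (n + 1) → K) → ℝ) :
    ∑ φ : Fin (n + 1) → K, (∏ j, p (φ j)) * F φ =
      ∑ φ : Fin n → K, (∏ j, p (φ j)) * ∑ k, p k * F (Fin.cons k φ) := by
  rw [← (Fin.consEquiv fun _ => K).sum_comp, Fintype.sum_prod_type, Finset.sum_comm]
  refine Finset.sum_congr rfl fun φ _ => ?_
  rw [Finset.mul_sum]
  refine Finset.sum_congr rfl fun k _ => ?_
  change (∏ j, p ((Fin.cons k φ : Fin (n + 1) → K) j)) * F (Fin.cons k φ) = _
  simp only [Fin.prod_univ_succ, Fin.cons_zero, Fin.cons_succ]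
  ring

open Classical in
/-- Finner's inequality on `Fin n → K` with a product probability weight: the functions `g i`
depend only on the coordinates in `S i`, and each coordinate lies in exactly `r` of these sets. -/
theorem Fin.sum_prod_mul_prod_rpow_le {ι K : Type*} [Fintype ι] [Fintype K]
    (r : ℕ) (hr : 1 ≤ r) (p : K → ℝ) (hp : ∀ k, 0 ≤ p k) (hp1 : ∑ k, p k = 1) (n : ℕ)
    (S : ι → Set (Fin n)) (hS : ∀ j, (Finset.univ.filter fun i => j ∈ S i).card = r)
    (g : ι → (Fin n → K) → ℝ) (hg : ∀ i φ, 0 ≤ g i φ)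
    (hgS : ∀ i φ ψ, (∀ j ∈ S i, φ j = ψ j) → g i φ = g i ψ) :
    ∑ φ : Fin n → K, (∏ j, p (φ j)) * ∏ i, g i φ ^ (1 / r : ℝ) ≤
      ∏ i, (∑ φ : Fin n → K, (∏ j, p (φ j)) * g i φ) ^ (1 / r : ℝ) := by
  induction n with
  | zero => simp
  | succ n ih =>
    simp_rw [Fin.sum_prod_mul_eq_sum_cons n p]
    refine le_trans (Finset.sum_le_sum fun φ _ => mul_le_mul_of_nonneg_left ?_
      (Finset.prod_nonneg fun j _ => hp _))
      (ih (fun i => {j | j.succ ∈ S i}) (fun j => hS j.succ)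
        (fun i φ => ∑ k, p k * g i (Fin.cons k φ))
        (fun i φ => Finset.sum_nonneg fun k _ => mul_nonneg (hp k) (hg i _)) ?_)
    · have hconst : ∀ i, 0 ∉ S i → ∀ k, g i (Fin.cons k φ) = ∑ l, p l * g i (Fin.cons l φ) := by
        intro i hi k
        have : ∀ l, g i (Fin.cons l φ) = g i (Fin.cons k φ) := fun l =>
          hgS i _ _ fun j hj => by
            cases j using Fin.cases with
            | zero => exact absurd hj hi
            | succ j => simp
        simp_rw [this, ← Finset.sum_mul, hp1, one_mul]
      rw [← Finset.prod_filter_mul_prod_filter_not Finset.univ (fun i => 0 ∈ S i)]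
      have hsplit : ∀ k, ∏ i, g i (Fin.cons k φ) ^ (1 / r : ℝ) =
          (∏ i with 0 ∈ S i, g i (Fin.cons k φ) ^ (1 / r : ℝ)) *
            ∏ i with 0 ∉ S i, (∑ l, p l * g i (Fin.cons l φ)) ^ (1 / r : ℝ) := by
        intro k
        rw [← Finset.prod_filter_mul_prod_filter_not Finset.univ (fun i => 0 ∈ S i)]
        congr 1
        exact Finset.prod_congr rfl fun i hi => by
          rw [hconst i (Finset.mem_filter.1 hi).2 k]
      simp_rw [hsplit, ← mul_assoc, ← Finset.sum_mul]
      refine mul_le_mul_of_nonneg_right ?_ (Finset.prod_nonneg fun i _ => Real.rpow_nonneg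
        (Finset.sum_nonneg fun k _ => mul_nonneg (hp k) (hg i _)) _)
      exact sum_mul_prod_rpow_le _ r hr (hS 0) p hp (fun i k => g i (Fin.cons k φ))
        fun i k => hg i _
    · intro i φ ψ h
      refine Finset.sum_congr rfl fun k _ => ?_
      congr 1
      refine hgS i _ _ fun j hj => ?_
      cases j using Fin.cases with
      | zero => simp
      | succ j => simpa using h j hj

open Classical in
/-- Finner's inequality on `V → K` with a product probability weight. -/
theorem Fintype.sum_prod_mul_prod_rpow_le {ι V K : Type*} [Fintype ι] [Fintype V]
    [DecidableEq V] [Fintype K]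
    (r : ℕ) (hr : 1 ≤ r) (p : K → ℝ) (hp : ∀ k, 0 ≤ p k) (hp1 : ∑ k, p k = 1)
    (S : ι → Set V) (hS : ∀ v, (Finset.univ.filter fun i => v ∈ S i).card = r)
    (g : ι → (V → K) → ℝ) (hg : ∀ i φ, 0 ≤ g i φ)
    (hgS : ∀ i φ ψ, (∀ v ∈ S i, φ v = ψ v) → g i φ = g i ψ) :
    ∑ φ : V → K, (∏ v, p (φ v)) * ∏ i, g i φ ^ (1 / r : ℝ) ≤
      ∏ i, (∑ φ : V → K, (∏ v, p (φ v)) * g i φ) ^ (1 / r : ℝ) := by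
  let e := Fintype.equivFin V
  have key : ∀ F : (V → K) → ℝ, ∑ φ : V → K, (∏ v, p (φ v)) * F φ =
      ∑ ψ : Fin (Fintype.card V) → K, (∏ j, p (ψ j)) * F (ψ ∘ e) := by
    intro F
    rw [← (e.symm.arrowCongr (Equiv.refl K)).sum_comp]
    refine Finset.sum_congr rfl fun ψ _ => ?_
    rw [← e.prod_comp]
    rfl
  simp_rw [key]
  exact Fin.sum_prod_mul_prod_rpow_le r hr p hp hp1 _ (fun i => {j | e.symm j ∈ S i})
    (fun j => hS (e.symm j)) (fun i ψ => g i (ψ ∘ e)) (fun i ψ => hg i _)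
    fun i φ ψ h => hgS i _ _ fun v hv => h (e v) (by simpa using hv)

/-- The marginal of a product probability weight on the coordinates in `s`. -/
theorem Fintype.sum_prod_mul_map_val {V K : Type*} [Fintype V] [DecidableEq V] [Fintype K]
    (p : K → ℝ) (hp1 : ∑ k, p k = 1) (s : Finset V) (r : ℕ) (hs : s.card = r)
    (F : Multiset K → ℝ) :
    ∑ φ : V → K, (∏ v, p (φ v)) * F (s.val.map φ) =
      ∑ f : Fin r → K, (∏ i, p (f i)) * F (Finset.univ.val.map f) := by
  let e : s ≃ Fin r := s.equivFinOfCardEq hs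
  have hsum : ∑ b : {v // v ∉ s} → K, ∏ v, p (b v) = 1 := by
    rw [← Fintype.piFinset_univ, ← Finset.prod_univ_sum]
    exact Finset.prod_eq_one fun _ _ => hp1
  rw [← (Equiv.piEquivPiSubtypeProd (· ∈ s) fun _ => K).symm.sum_comp, Fintype.sum_prod_type,
    ← (e.symm.arrowCongr (Equiv.refl K)).sum_comp]
  refine Finset.sum_congr rfl fun f _ => ?_
  set a : s → K := e.symm.arrowCongr (Equiv.refl K) f
  have hprod : ∏ i, p (f i) = ∏ x, p (a x) := by
    rw [← e.prod_comp]
    rfl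
  have hmap : Finset.univ.val.map f = Finset.univ.val.map a := by
    rw [← Finset.map_univ_equiv e, Finset.map_val, Multiset.map_map]
    rfl
  rw [hprod, hmap, ← mul_one (∏ x, p (a x)), ← hsum, Finset.mul_sum, Finset.sum_mul]
  refine Finset.sum_congr rfl fun b _ => ?_
  set φ : V → K := (Equiv.piEquivPiSubtypeProd (· ∈ s) fun _ => K).symm (a, b) with hφ
  have hφa : ∀ x : s, φ x = a x := fun x => by simp [hφ]
  have hφb : ∀ x : {v // v ∉ s}, φ x = b x := fun x => by simp [hφ, x.2]
  congr 1
  · rw [← Fintype.prod_subtype_mul_prod_subtype (· ∈ s)]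
    simp_rw [hφb]
    congr 1
    exact Finset.prod_congr (by ext x; simp) fun x _ => congrArg p (hφa x)
  · rw [← Multiset.attach_map_val' s.val φ]
    congr 1
    exact Multiset.map_congr rfl fun x _ => hφa x


/-- Weighted version: the total weight of all `𝓛`-legal (open) neighborhood colorings of
an `r`-regular graph `G` on `n` vertices is at most `N^λ(r,𝓛)^(n/r)`. -/
theorem stmt4 {V K : Type*} [Fintype V] [DecidableEq V] [Fintype K] [DecidableEq K] (G : SimpleGraph V)
    [DecidableRel G.Adj] (r : ℕ) (hr : 1 ≤ r) (hreg : G.IsRegularOfDegree r)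
    (𝓛 : Finset (Multiset K)) (lam : K → ℝ) (hlam : ∀ x, 0 < lam x) :
    (∑ φ ∈ Finset.univ.filter (fun φ : V → K => ∀ v : V, (G.neighborFinset v).val.map φ ∈ 𝓛),
        ∏ v : V, lam (φ v)) ≤
      (∑ f ∈ Finset.univ.filter (fun f : Fin r → K => Finset.univ.val.map f ∈ 𝓛),
        ∏ i : Fin r, lam (f i)) ^ ((Fintype.card V : ℝ) / r) := by
  classical
  have hr0 : (0 : ℝ) < r := by exact_mod_cast hr
  have hne : (1 / r : ℝ) ≠ 0 := by positivity
  rcases isEmpty_or_nonempty V with hV | hV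
  · refine (Finset.sum_le_univ_sum_of_nonneg fun φ => ?_).trans ?_ <;> simp
  rcases isEmpty_or_nonempty K with hK | hK
  · rw [Finset.univ_eq_empty, Finset.filter_empty, Finset.sum_empty]
    exact Real.rpow_nonneg (Finset.sum_nonneg fun f _ => Finset.prod_nonneg fun i _ =>
      (hlam _).le) _
  set Λ := ∑ k, lam k
  have hΛ0 : 0 < Λ := Finset.sum_pos (fun k _ => hlam k) Finset.univ_nonempty
  have hp1 : ∑ k, lam k / Λ = 1 := by rw [← Finset.sum_div, div_self hΛ0.ne']
  let F : Multiset K → ℝ := fun m => if m ∈ 𝓛 then 1 else 0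
  have hF : ∀ m, 0 ≤ F m := fun m => by
    simp only [F]
    split_ifs <;> norm_num
  have hFr : ∀ m, F m ^ (1 / r : ℝ) = F m := fun m => by
    simp only [F]
    split_ifs
    · exact Real.one_rpow _
    · exact Real.zero_rpow hne
  have key := Fintype.sum_prod_mul_prod_rpow_le r hr (fun k => lam k / Λ)
    (fun k => (div_pos (hlam k) hΛ0).le) hp1 (fun v => {u | u ∈ G.neighborFinset v})
    (fun u => by
      rw [← hreg u, ← G.card_neighborFinset_eq_degree]
      congr 1
      ext v
      simp [G.adj_comm])
    (fun v φ => F ((G.neighborFinset v).val.map φ)) (fun v φ => hF _)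
    (fun v φ ψ h => congrArg F (Multiset.map_congr rfl h))
  have hmarg := fun v => Fintype.sum_prod_mul_map_val (fun k => lam k / Λ) hp1
    (G.neighborFinset v) r ((G.card_neighborFinset_eq_degree v).trans (hreg v)) F
  simp only [hFr] at key
  simp_rw [hmarg, Finset.prod_div_distrib,
    Finset.prod_const, Finset.card_univ, Fintype.card_fin, div_mul_eq_mul_div,
    ← Finset.sum_div] at key
  have hN : ∑ f : Fin r → K, (∏ i, lam (f i)) * F (Finset.univ.val.map f) =
      ∑ f ∈ Finset.univ.filter (fun f : Fin r → K => Finset.univ.val.map f ∈ 𝓛),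
        ∏ i : Fin r, lam (f i) := by
    rw [Finset.sum_filter]
    exact Finset.sum_congr rfl fun f _ => by simp [F]
  have hL : ∑ φ : V → K, (∏ v, lam (φ v)) * ∏ v, F ((G.neighborFinset v).val.map φ) =
      ∑ φ ∈ Finset.univ.filter (fun φ : V → K => ∀ v : V, (G.neighborFinset v).val.map φ ∈ 𝓛),
        ∏ v : V, lam (φ v) := by
    rw [Finset.sum_filter]
    refine Finset.sum_congr rfl fun φ _ => ?_
    simp [F, Finset.prod_ite_zero]
  have hN0 : 0 ≤ ∑ f ∈ Finset.univ.filter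
      (fun f : Fin r → K => Finset.univ.val.map f ∈ 𝓛), ∏ i : Fin r, lam (f i) :=
    Finset.sum_nonneg fun f _ => Finset.prod_nonneg fun i _ => (hlam _).le
  rw [hN, hL, Real.div_rpow hN0 (by positivity), one_div, Real.pow_rpow_inv_natCast hΛ0.le
    (by omega), div_pow, div_le_div_iff_of_pos_right (by positivity), ← Real.rpow_mul_natCast hN0,
    inv_mul_eq_div] at key
  exact key
end

section
/- If T is a tree on n ≥ 2 vertices, then the number of 2-colorings φ: V(T) → {a,b} in which every vertex has a neighbor of the same color is at most the corresponding number for the path P_n, with equality if and only if T = P_n. -/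
namespace SimpleGraph

variable {V : Type*}

/-- The edge covers of the subgraph of `G` induced by `S`, as spanning subgraphs of `G`. -/
def edgeCovers (G : SimpleGraph V) (S : Set V) : Set (SimpleGraph V) :=
  {H | H ≤ G ∧ H.support = S}

/-- The number of edge covers of a path on `n` vertices. -/
def pathEdgeCoverCount : ℕ → ℕ
  | 0 => 1
  | 1 => 0
  | n + 2 => pathEdgeCoverCount (n + 1) + pathEdgeCoverCount n

/-- The colorings in which every vertex has a neighbor of its own color. -/
def sociableColorings (G : SimpleGraph V) : Set (V → Bool) :=
  {φ | ∀ v, ∃ w, G.Adj v w ∧ φ v = φ w}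

theorem pathEdgeCoverCount_pos (n : ℕ) : 0 < pathEdgeCoverCount (n + 2) := by
  induction n with
  | zero => decide
  | succ n ih => exact Nat.add_pos_left ih _

theorem IsAcyclic.exists_adj_forall_adj_eq [Finite V] {G : SimpleGraph V} (hG : G.IsAcyclic)
    {a b : V} (hab : G.Adj a b) : ∃ v u, G.Adj v u ∧ ∀ w, G.Adj v w → w = u := by
  have : Nonempty V := ⟨a⟩
  obtain ⟨u, v, p, hp, hmax⟩ := Walk.exists_isPath_forall_isPath_length_le_length G
  have hnil : ¬p.Nil := by
    have h1 := hmax _ _ _ (Path.singleton hab).2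
    intro h
    have h2 := Walk.length_eq_zero_iff.mpr h
    simp [Path.singleton] at h1
    omega
  refine ⟨u, p.snd, p.adj_snd hnil, fun w hadj ↦ ?_⟩
  apply hG.eq_snd_of_adj_start hp hadj
  have : ¬(p.cons hadj.symm).IsPath := fun h ↦ by
    have := hmax _ _ _ h
    simp at this
  by_contra hw
  exact this (hp.cons hw)

theorem ncard_edgeCovers_le_add [Finite V] {G : SimpleGraph V} {S : Set V} {v u : V}
    (hv : v ∈ S) (hvu : G.Adj v u) (huniq : ∀ w ∈ S, G.Adj v w → w = u) :
    (G.edgeCovers S).ncard ≤ (G.edgeCovers (S \ {v})).ncard +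
      (G.edgeCovers (S \ {v, u})).ncard := by
  refine le_trans ?_ (Set.ncard_union_le _ _)
  have hedge : ∀ H ∈ G.edgeCovers S, ∀ w, H.Adj v w ↔ w = u := by
    rintro H ⟨hle, hS⟩
    have key : ∀ w, H.Adj v w → w = u := fun w hw ↦
      huniq w (hS ▸ ⟨v, hw.symm⟩) (hle hw)
    obtain ⟨w, hw⟩ : v ∈ H.support := hS ▸ hv
    intro w'
    refine ⟨key w', ?_⟩
    rintro rfl
    exact key w hw ▸ hw
  apply Set.ncard_le_ncard_of_injOn (fun H ↦ H.deleteEdges {s(v, u)}) _ _ (Set.toFinite _)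
  · rintro H hH
    have he := hedge H hH
    obtain ⟨hle, hS⟩ := hH
    have hle' : H.deleteEdges {s(v, u)} ≤ G := (deleteEdges_le _).trans hle
    have hmem : ∀ x, x ≠ v → x ≠ u → (x ∈ (H.deleteEdges {s(v, u)}).support ↔ x ∈ S) := by
      intro x hxv hxu
      rw [← hS, mem_support, mem_support]
      simp [hxv, hxu]
    have hvn : v ∉ (H.deleteEdges {s(v, u)}).support := by
      rw [mem_support]
      rintro ⟨w, hw⟩
      rw [deleteEdges_adj] at hw
      exact hw.2 (by rw [(he w).1 hw.1]; rfl)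
    have huS : u ∈ S := hS ▸ ⟨v, ((he u).2 rfl).symm⟩
    by_cases hu : u ∈ (H.deleteEdges {s(v, u)}).support
    · left
      refine ⟨hle', ?_⟩
      ext x
      by_cases hxv : x = v
      · subst hxv; simp [hvn]
      by_cases hxu : x = u
      · subst hxu; simp [hu, huS, hxv]
      · simp [hmem x hxv hxu, hxv]
    · right
      refine ⟨hle', ?_⟩
      ext x
      by_cases hxv : x = v
      · subst hxv; simp [hvn]
      by_cases hxu : x = u
      · subst hxu; simp [hu]
      · simp [hmem x hxv hxu, hxv, hxu]
  · intro H hH K hK hHK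
    ext x y
    have h1 := congrArg (fun L ↦ L.Adj x y) hHK
    simp only [deleteEdges_adj, Set.mem_singleton_iff, eq_iff_iff] at h1
    by_cases hxy : s(x, y) = s(v, u)
    · have h2 : s(v, u) ∈ H.edgeSet := (hedge H hH u).2 rfl
      have h3 : s(v, u) ∈ K.edgeSet := (hedge K hK u).2 rfl
      rw [← hxy] at h2 h3
      exact ⟨fun _ ↦ h3, fun _ ↦ h2⟩
    · simpa [hxy] using h1

theorem reachable_of_isChain {G : SimpleGraph V} {l : List V} (hl : l.IsChain G.Adj)
    {x y : V} (hx : x ∈ l) (hy : y ∈ l) : G.Reachable x y := by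
  have hp : l.Pairwise G.Reachable :=
    have : IsTrans V G.Reachable := ⟨fun _ _ _ ↦ Reachable.trans⟩
    (hl.imp fun _ _ h ↦ h.reachable).pairwise
  exact by
    have : Std.Symm G.Reachable := ⟨fun _ _ ↦ Reachable.symm⟩
    exact hp.forall_of_forall (fun _ _ ↦ Reachable.refl _) hx hy

theorem IsAcyclic.exists_isChain_insert {G : SimpleGraph V} (hG : G.IsAcyclic) {S : Set V}
    {v u : V} (hv : v ∈ S) (huS : u ∈ S) (hvu : G.Adj v u)
    (h₁ : ∃ l : List V, l.Nodup ∧ l.IsChain G.Adj ∧ ∀ x, x ∈ l ↔ x ∈ S \ {v})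
    (h₂ : ∃ l : List V, l.Nodup ∧ l.IsChain G.Adj ∧ ∀ x, x ∈ l ↔ x ∈ S \ {v, u}) :
    ∃ l : List V, l.Nodup ∧ l.IsChain G.Adj ∧ ∀ x, x ∈ l ↔ x ∈ S := by
  obtain ⟨l, hnd, hch, hmem⟩ := h₁
  obtain ⟨l', -, hch', hmem'⟩ := h₂
  have hul : u ∈ l := (hmem u).2 ⟨huS, hvu.ne'⟩
  have hvl : v ∉ l := fun h ↦ ((hmem v).1 h).2 rfl
  have hcons : ∀ m : List V, m.Perm l → m.IsChain G.Adj → m.head? = some u →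
      ∃ l : List V, l.Nodup ∧ l.IsChain G.Adj ∧ ∀ x, x ∈ l ↔ x ∈ S := by
    intro m hm hmch hhead
    refine ⟨v :: m, ?_, ?_, ?_⟩
    · exact List.nodup_cons.2 ⟨fun h ↦ hvl (hm.mem_iff.1 h), hm.nodup_iff.2 hnd⟩
    · rw [List.isChain_cons]
      exact ⟨fun y hy ↦ by simp_all, hmch⟩
    · intro x
      rw [List.mem_cons, hm.mem_iff, hmem]
      by_cases hx : x = v
      · simp [hx, hv]
      · simp [hx]
  obtain ⟨a, b, rfl⟩ := List.append_of_mem hul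
  rcases a.eq_nil_or_concat with rfl | ⟨a, x, rfl⟩
  · exact hcons _ (List.Perm.refl _) hch (by simp)
  rcases b with _ | ⟨y, b⟩
  · refine hcons _ (List.reverse_perm _) ?_ (by simp)
    rw [List.isChain_reverse]
    exact hch.imp fun _ _ h ↦ h.symm
  exfalso
  have hxu : G.Adj x u := by
    simp [List.isChain_append, List.isChain_cons] at hch
    grind
  have huy : G.Adj u y := by
    simp [List.isChain_append, List.isChain_cons] at hch
    grind
  have hxy : x ≠ y := by
    rintro rfl
    simp [List.nodup_append] at hnd
  have hbr := isAcyclic_iff_forall_adj_isBridge.1 hG hxu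
  rw [isBridge_iff] at hbr
  have hl : ∀ z ∈ l', z ≠ u := fun z hz h ↦ ((hmem' z).1 hz).2 (by simp [h])
  have hx' : x ∈ l' := (hmem' x).2 ⟨((hmem x).1 (by simp)).1, by
    simp only [Set.mem_insert_iff, Set.mem_singleton_iff, not_or]
    exact ⟨((hmem x).1 (by simp)).2, hxu.ne⟩⟩
  have hy' : y ∈ l' := (hmem' y).2 ⟨((hmem y).1 (by simp)).1, by
    simp only [Set.mem_insert_iff, Set.mem_singleton_iff, not_or]
    exact ⟨((hmem y).1 (by simp)).2, huy.ne'⟩⟩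
  have hchd : l'.IsChain (G.deleteEdges {s(x, u)}).Adj :=
    hch'.imp_of_mem_imp fun a b ha hb hab ↦ by
      rw [deleteEdges_adj]
      refine ⟨hab, ?_⟩
      simp [hl a ha, hl b hb]
  refine hbr ((reachable_of_isChain hchd hx' hy').trans (Adj.reachable ?_))
  rw [deleteEdges_adj]
  refine ⟨huy.symm, ?_⟩
  simp [hxy.symm, huy.ne']

theorem IsAcyclic.ncard_edgeCovers_le [Finite V] {G : SimpleGraph V} (hG : G.IsAcyclic) (n : ℕ) :
    ∀ S : Set V, S.ncard = n → (G.edgeCovers S).ncard ≤ pathEdgeCoverCount n ∧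
      ((G.edgeCovers S).ncard = pathEdgeCoverCount n →
        ∃ l : List V, l.Nodup ∧ l.IsChain G.Adj ∧ ∀ x, x ∈ l ↔ x ∈ S) := by
  induction n using Nat.strong_induction_on with
  | _ n ih =>
  intro S hS
  rcases (G.edgeCovers S).eq_empty_or_nonempty with hE | ⟨H, hle, hHS⟩
  · rw [hE, Set.ncard_empty]
    refine ⟨Nat.zero_le _, fun h ↦ ?_⟩
    match n with
    | 0 => simp [pathEdgeCoverCount] at h
    | 1 =>
      obtain ⟨a, rfl⟩ := Set.ncard_eq_one.1 hS
      exact ⟨[a], by simp, by simp, by simp⟩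
    | n + 2 => exact absurd h (pathEdgeCoverCount_pos n).ne
  rcases S.eq_empty_or_nonempty with rfl | ⟨a, ha⟩
  · obtain rfl : n = 0 := by simpa using hS.symm
    refine ⟨?_, fun _ ↦ ⟨[], by simp, by simp, by simp⟩⟩
    rw [pathEdgeCoverCount, Set.ncard_le_one]
    rintro H ⟨-, hH⟩ K ⟨-, hK⟩
    rw [support_eq_bot_iff] at hH hK
    rw [hH, hK]
  let G' : SimpleGraph V :=
    { Adj := fun x y ↦ G.Adj x y ∧ x ∈ S ∧ y ∈ S
      symm := ⟨fun x y h ↦ ⟨h.1.symm, h.2.2, h.2.1⟩⟩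
      loopless := ⟨fun x h ↦ h.1.ne rfl⟩ }
  have hG' : G'.IsAcyclic := hG.anti fun x y h ↦ h.1
  obtain ⟨b, hab⟩ : a ∈ H.support := hHS ▸ ha
  have hab' : G'.Adj a b := ⟨hle hab, ha, hHS ▸ ⟨a, hab.symm⟩⟩
  obtain ⟨v, u, ⟨hvu, hv, hu⟩, huniq⟩ := hG'.exists_adj_forall_adj_eq hab'
  have hadd := ncard_edgeCovers_le_add hv hvu fun w hw h ↦ huniq w ⟨h, hv, hw⟩
  have hc₁ : (S \ {v}).ncard + 1 = n := by
    rw [Set.ncard_sdiff_singleton_add_one hv, hS]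
  have hc₂ : (S \ {v, u}).ncard + 2 = n := by
    rw [← hS, ← Set.ncard_pair hvu.ne]
    exact Set.ncard_sdiff_add_ncard_of_subset (by simp [Set.insert_subset_iff, hv, hu])
  obtain ⟨n, rfl⟩ : ∃ m, n = m + 2 := ⟨_, hc₂.symm⟩
  obtain ⟨hle₁, heq₁⟩ := ih (n + 1) (by omega) (S \ {v}) (by omega)
  obtain ⟨hle₂, heq₂⟩ := ih n (by omega) (S \ {v, u}) (by omega)
  rw [pathEdgeCoverCount]
  exact ⟨by omega, fun h ↦ hG.exists_isChain_insert hv hu hvu (heq₁ (by omega)) (heq₂ (by omega))⟩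

theorem Connected.ncard_sociableColorings_le [Finite V] {G : SimpleGraph V} (hG : G.Connected) :
    G.sociableColorings.ncard ≤ 2 * (G.edgeCovers Set.univ).ncard := by
  obtain ⟨r⟩ := hG.nonempty
  have h2 : 2 * (G.edgeCovers Set.univ).ncard =
      ((Set.univ : Set Bool) ×ˢ G.edgeCovers Set.univ).ncard := by
    simp [Set.ncard_prod]
  rw [h2]
  let mono : (V → Bool) → SimpleGraph V := fun φ ↦
    { Adj := fun x y ↦ G.Adj x y ∧ φ x = φ y
      symm := ⟨fun x y h ↦ ⟨h.1.symm, h.2.symm⟩⟩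
      loopless := ⟨fun x h ↦ h.1.ne rfl⟩ }
  apply Set.ncard_le_ncard_of_injOn (fun φ ↦ (φ r, mono φ)) _ _ (Set.toFinite _)
  · intro φ hφ
    exact ⟨Set.mem_univ _, fun x y h ↦ h.1, Set.eq_univ_of_forall hφ⟩
  · intro φ _ ψ _ h
    obtain ⟨hr, hm⟩ := Prod.ext_iff.1 h
    have hadj : ∀ x y, G.Adj x y → (φ x = φ y ↔ ψ x = ψ y) := fun x y hxy ↦ by
      have := congrArg (fun L ↦ L.Adj x y) hm
      simpa [mono, hxy] using this
    funext x
    obtain ⟨p⟩ := hG.preconnected r x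
    change φ r = ψ r at hr
    clear h hm
    induction p with
    | nil => exact hr
    | @cons a b c hab p ihp =>
      refine ihp ?_
      have := hadj _ _ hab
      revert this hr
      cases φ a <;> cases φ b <;> cases ψ a <;> cases ψ b <;> simp

theorem sociableColorings_pathGraph_cons {n : ℕ} {φ : Fin (n + 1) → Bool}
    (hφ : φ ∈ (pathGraph (n + 1)).sociableColorings) :
    Fin.cons (φ 0) φ ∈ (pathGraph (n + 2)).sociableColorings := by
  intro v
  refine Fin.cases ?_ (fun i ↦ ?_) v
  · exact ⟨Fin.succ 0, by simp [pathGraph_adj], by simp⟩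
  · obtain ⟨w, hw, h⟩ := hφ i
    exact ⟨w.succ, by simpa [pathGraph_adj] using hw, by simpa using h⟩

theorem sociableColorings_pathGraph_cons_cons {n : ℕ} (c : Bool) {φ : Fin n → Bool}
    (hφ : φ ∈ (pathGraph n).sociableColorings) :
    (Fin.cons c (Fin.cons c φ : Fin (n + 1) → Bool) : Fin (n + 2) → Bool) ∈
      (pathGraph (n + 2)).sociableColorings := by
  intro v
  refine Fin.cases ?_ (fun i ↦ Fin.cases ?_ (fun j ↦ ?_) i) v
  · exact ⟨Fin.succ 0, by simp [pathGraph_adj], by simp⟩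
  · exact ⟨0, by simp [pathGraph_adj], by simp⟩
  · obtain ⟨w, hw, h⟩ := hφ j
    exact ⟨w.succ.succ, by simpa [pathGraph_adj] using hw, by simpa using h⟩

theorem ncard_sociableColorings_pathGraph_add_le (n : ℕ) :
    (pathGraph (n + 2)).sociableColorings.ncard + (pathGraph (n + 1)).sociableColorings.ncard ≤
      (pathGraph (n + 3)).sociableColorings.ncard := by
  let f : (Fin (n + 2) → Bool) → (Fin (n + 3) → Bool) := fun φ ↦ Fin.cons (φ 0) φ
  let g : (Fin (n + 1) → Bool) → (Fin (n + 3) → Bool) := fun φ ↦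
    Fin.cons (!φ 0) (Fin.cons (!φ 0) φ : Fin (n + 2) → Bool)
  have hf : f.Injective := fun φ ψ h ↦ (Fin.cons_inj.1 h).2
  have hg : g.Injective := fun φ ψ h ↦ (Fin.cons_inj.1 (Fin.cons_inj.1 h).2).2
  have hdisj : Disjoint (f '' (pathGraph (n + 2)).sociableColorings)
      (g '' (pathGraph (n + 1)).sociableColorings) := by
    rw [Set.disjoint_left]
    rintro _ ⟨φ, hφ, rfl⟩ ⟨ψ, -, h⟩
    obtain rfl := (Fin.cons_inj.1 h).2
    obtain ⟨w, hw, hc⟩ := hφ 0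
    obtain rfl : w = Fin.succ 0 := by
      rw [pathGraph_adj] at hw
      ext
      simp at hw ⊢
      omega
    simp at hc
  rw [← Set.ncard_image_of_injective _ hf, ← Set.ncard_image_of_injective _ hg,
    ← Set.ncard_union_eq hdisj]
  refine Set.ncard_le_ncard ?_ (Set.toFinite _)
  rintro _ (⟨φ, hφ, rfl⟩ | ⟨φ, hφ, rfl⟩)
  · exact sociableColorings_pathGraph_cons hφ
  · exact sociableColorings_pathGraph_cons_cons _ hφ

theorem le_ncard_sociableColorings_pathGraph (n : ℕ) :
    2 * pathEdgeCoverCount (n + 1) ≤ (pathGraph (n + 1)).sociableColorings.ncard := by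
  induction n using Nat.twoStepInduction with
  | zero => simp [pathEdgeCoverCount]
  | one =>
    have hsub : (Set.range fun (c : Bool) (_ : Fin 2) ↦ c) ⊆ (pathGraph 2).sociableColorings := by
      rintro _ ⟨c, rfl⟩ v
      exact ⟨v.rev, by fin_cases v <;> simp [pathGraph_adj], rfl⟩
    refine le_trans ?_ (Set.ncard_le_ncard hsub (Set.toFinite _))
    rw [← Set.image_univ, Set.ncard_image_of_injective _ fun c d h ↦ congrFun h 0]
    simp [pathEdgeCoverCount]
  | more n ih₀ ih₁ =>
    have := ncard_sociableColorings_pathGraph_add_le n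
    change 2 * pathEdgeCoverCount (n + 2) ≤ (pathGraph (n + 2)).sociableColorings.ncard at ih₁
    change 2 * (pathEdgeCoverCount (n + 2) + pathEdgeCoverCount (n + 1)) ≤
      (pathGraph (n + 3)).sociableColorings.ncard
    omega

theorem ncard_sociableColorings_congr {W : Type*} {G : SimpleGraph V}
    {G' : SimpleGraph W} (e : G ≃g G') :
    G.sociableColorings.ncard = G'.sociableColorings.ncard := by
  have : (fun φ : W → Bool ↦ φ ∘ e) '' G'.sociableColorings = G.sociableColorings := by
    ext φ
    constructor
    · rintro ⟨ψ, hψ, rfl⟩ v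
      obtain ⟨w, hw, h⟩ := hψ (e v)
      exact ⟨e.symm w, by rw [← e.map_adj_iff]; simpa using hw, by simpa using h⟩
    · intro hφ
      refine ⟨φ ∘ e.symm, fun v ↦ ?_, by ext; simp⟩
      obtain ⟨w, hw, h⟩ := hφ (e.symm v)
      exact ⟨e w, by rw [← e.symm.map_adj_iff]; simpa using hw, by simpa using h⟩
  rw [← this, Set.ncard_image_of_injective]
  intro φ ψ h
  funext x
  simpa using congrFun h (e.symm x)

theorem IsTree.nonempty_iso_pathGraph [Fintype V] {G : SimpleGraph V} (hG : G.IsTree)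
    {l : List V} (hnd : l.Nodup) (hch : l.IsChain G.Adj) (hmem : ∀ x, x ∈ l) :
    Nonempty (G ≃g pathGraph (Fintype.card V)) := by
  classical
  let e : Fin l.length ≃ V := hnd.getEquivOfForallMemList l hmem
  have hlen : l.length = Fintype.card V := by simpa using Fintype.card_congr e
  rw [← hlen]
  have hle : (pathGraph l.length).map e.toEmbedding ≤ G := by
    rw [map_le_iff_le_comap]
    have hget := List.isChain_iff_getElem.1 hch
    intro i j hij
    rw [pathGraph_adj] at hij
    rcases hij with h | h
    · have := hget i (by omega)
      simpa [e, h] using this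
    · have := hget j (by omega)
      simpa [e, h] using this.symm
  have hpos : l.length ≠ 0 := by
    obtain ⟨r⟩ := hG.connected.nonempty
    exact (List.length_pos_of_mem (hmem r)).ne'
  have hconn : (pathGraph l.length).Connected := by
    obtain ⟨m, hm⟩ := Nat.exists_eq_succ_of_ne_zero hpos
    rw [hm]
    exact pathGraph_connected m
  have iso : pathGraph l.length ≃g (pathGraph l.length).map e.toEmbedding := Iso.map e _
  have heq : (pathGraph l.length).map e.toEmbedding = G :=
    le_antisymm hle ((isTree_iff_minimal_connected.1 hG).2 (iso.connected_iff.1 hconn) hle)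
  exact ⟨heq ▸ iso.symm⟩

end SimpleGraph

/-- If `T` is a tree on `n ≥ 2` vertices, then the number of two-colorings of `T` in which
every vertex has a neighbor of the same color is at most the corresponding number for the
path `P_n`, with equality if and only if `T` is (isomorphic to) `P_n`. -/
theorem stmt15 {V : Type*} [Fintype V] (T : SimpleGraph V) (hT : T.IsTree)
    (hn : 2 ≤ Fintype.card V) :
    {φ : V → Bool | ∀ v : V, ∃ w : V, T.Adj v w ∧ φ v = φ w}.ncard ≤
      {φ : Fin (Fintype.card V) → Bool | ∀ v, ∃ w,
        (SimpleGraph.pathGraph (Fintype.card V)).Adj v w ∧ φ v = φ w}.ncard ∧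
    ({φ : V → Bool | ∀ v : V, ∃ w : V, T.Adj v w ∧ φ v = φ w}.ncard =
      {φ : Fin (Fintype.card V) → Bool | ∀ v, ∃ w,
        (SimpleGraph.pathGraph (Fintype.card V)).Adj v w ∧ φ v = φ w}.ncard ↔
      Nonempty (T ≃g SimpleGraph.pathGraph (Fintype.card V))) := by
  have hconn := hT.connected
  have h₁ := hconn.ncard_sociableColorings_le
  obtain ⟨h₂, h₃⟩ := hT.isAcyclic.ncard_edgeCovers_le (Fintype.card V) Set.univ
    (by rw [Set.ncard_univ, Nat.card_eq_fintype_card])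
  have h₄ := SimpleGraph.le_ncard_sociableColorings_pathGraph (Fintype.card V - 1)
  rw [Nat.sub_add_cancel (by omega)] at h₄
  change T.sociableColorings.ncard ≤
    (SimpleGraph.pathGraph (Fintype.card V)).sociableColorings.ncard ∧
    (T.sociableColorings.ncard =
      (SimpleGraph.pathGraph (Fintype.card V)).sociableColorings.ncard ↔ _)
  refine ⟨by omega, fun h ↦ ?_, fun ⟨e⟩ ↦ SimpleGraph.ncard_sociableColorings_congr e⟩
  obtain ⟨l, hnd, hch, hmem⟩ := h₃ (by omega)
  exact hT.nonempty_iso_pathGraph hnd hch fun x ↦ (hmem x).2 (Set.mem_univ x)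
end

section
/- If G is a 2-regular graph on n vertices, then the number of existence homomorphisms from G to E_2 is at most c_6^(n/6), where c_6 is the number of existence homomorphisms from the 6-cycle C_6 to E_2. -/
open Finset in
/-- Continuations, of length `n`, of a two-letter word `ab` to a word ending in `cd` all of whose
interior letters agree with a neighboring letter. -/
def supportedWords : ℕ → Bool → Bool → Bool → Bool → Finset (List Bool)
  | 0, a, b, c, d => if a = c ∧ b = d then {[]} else ∅
  | n + 1, a, b, c, d => univ.biUnion fun e =>
      if b = a ∨ b = e then (supportedWords n b e c d).image (List.cons e) else ∅

/-- The transfer matrix on pairs of consecutive colors. -/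
def transferMatrix : Matrix (Bool × Bool) (Bool × Bool) ℤ :=
  Matrix.of fun s t => if t.1 = s.2 ∧ (s.2 = s.1 ∨ s.2 = t.2) then 1 else 0

theorem card_supportedWords_le (n : ℕ) (a b c d : Bool) :
    ((supportedWords n a b c d).card : ℤ) ≤ (transferMatrix ^ n) (a, b) (c, d) := by
  induction n generalizing a b with
  | zero => by_cases h : a = c ∧ b = d <;> simp [supportedWords, h]
  | succ n ih =>
    rw [pow_succ', Matrix.mul_apply, Fintype.sum_prod_type, Finset.sum_eq_single b]
    · refine (Nat.cast_le.mpr Finset.card_biUnion_le).trans ?_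
      rw [Nat.cast_sum]
      refine Finset.sum_le_sum fun e _ => ?_
      by_cases h : b = a ∨ b = e
      · simp only [h, if_true, transferMatrix, Matrix.of_apply, and_self, one_mul]
        exact (Nat.cast_le.mpr Finset.card_image_le).trans (ih b e)
      · simp [h, transferMatrix]
    · intro e _ he
      simp [transferMatrix, he]
    · simp

theorem map_range_mem_supportedWords (n : ℕ) (f : ℕ → Bool)
    (hf : ∀ i, f (i + 1) = f i ∨ f (i + 1) = f (i + 2)) :
    (List.range n).map (fun i => f (i + 2)) ∈
      supportedWords n (f 0) (f 1) (f n) (f (n + 1)) := by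
  induction n generalizing f with
  | zero => simp [supportedWords]
  | succ n ih =>
    have h := ih (fun i => f (i + 1)) fun i => hf (i + 1)
    rw [supportedWords, Finset.mem_biUnion]
    refine ⟨f 2, Finset.mem_univ _, ?_⟩
    rw [if_pos (hf 0), Finset.mem_image]
    refine ⟨_, h, ?_⟩
    simp [List.range_succ_eq_map, Function.comp_def]

theorem trace_transferMatrix_pow_add_four (n : ℕ) :
    (transferMatrix ^ (n + 4)).trace = 2 * (transferMatrix ^ (n + 3)).trace -
      (transferMatrix ^ (n + 2)).trace + (transferMatrix ^ n).trace := by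
  have h : transferMatrix ^ 4 =
      transferMatrix ^ 3 + transferMatrix ^ 3 - transferMatrix ^ 2 + 1 := by decide +kernel
  rw [pow_add, h, mul_add, mul_sub, mul_add, ← pow_add, ← pow_add, mul_one, Matrix.trace_add,
    Matrix.trace_sub, Matrix.trace_add]
  ring

/-- The sequence with `p 0 = 2`, `p 1 = 1` and `p (n + 2) = p (n + 1) - p n`. -/
def hexPeriodic : ℕ → ℤ
  | 0 => 2
  | 1 => 1
  | n + 2 => hexPeriodic (n + 1) - hexPeriodic n

theorem hexPeriodic_add_six (n : ℕ) : hexPeriodic (n + 6) = hexPeriodic n := by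
  simp only [hexPeriodic]
  ring

theorem abs_hexPeriodic_le (n : ℕ) : |hexPeriodic n| ≤ 2 := by
  induction n using Nat.strong_induction_on with
  | _ n ih =>
    by_cases h : n < 6
    · interval_cases n <;> decide
    · obtain ⟨m, rfl⟩ := Nat.exists_eq_add_of_le' (not_lt.mp h)
      rw [hexPeriodic_add_six]
      exact ih m (by omega)

theorem trace_transferMatrix_pow (n : ℕ) :
    (transferMatrix ^ n).trace = 2 * (Nat.fib (n + 1) : ℤ) - Nat.fib n + hexPeriodic n := by
  induction n using Nat.strong_induction_on with
  | _ n ih =>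
    by_cases h : n < 4
    · interval_cases n <;> decide +kernel
    · obtain ⟨m, rfl⟩ := Nat.exists_eq_add_of_le' (not_lt.mp h)
      rw [trace_transferMatrix_pow_add_four, ih (m + 3) (by omega), ih (m + 2) (by omega),
        ih m (by omega)]
      simp only [hexPeriodic, Nat.fib_add_two, Nat.cast_add]
      ring

theorem trace_transferMatrix_pow_add_six_le (n : ℕ) (hn : 7 ≤ n) :
    (transferMatrix ^ (n + 6)).trace ≤ 20 * (transferMatrix ^ n).trace := by
  have hp := abs_le.mp (abs_hexPeriodic_le n)
  rw [trace_transferMatrix_pow, trace_transferMatrix_pow, hexPeriodic_add_six]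
  obtain ⟨m, rfl⟩ := Nat.exists_eq_add_of_le' hn
  have h : 1 ≤ Nat.fib (m + 1) := Nat.fib_pos.mpr (by omega)
  simp only [Nat.fib_add_two, Nat.cast_add]
  omega

theorem trace_transferMatrix_pow_nonneg (n : ℕ) : 0 ≤ (transferMatrix ^ n).trace :=
  Finset.sum_nonneg fun s _ =>
    (Nat.cast_nonneg _).trans (card_supportedWords_le n s.1 s.2 s.1 s.2)

theorem trace_transferMatrix_pow_le (n : ℕ) (hn : 2 ≤ n) :
    (transferMatrix ^ n).trace ^ 6 ≤ 20 ^ n := by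
  induction n using Nat.strong_induction_on with
  | _ n ih =>
    by_cases h : n < 13
    · rw [trace_transferMatrix_pow]
      interval_cases n <;> decide +kernel
    · obtain ⟨m, rfl⟩ := Nat.exists_eq_add_of_le' (show 6 ≤ n by omega)
      calc (transferMatrix ^ (m + 6)).trace ^ 6
          ≤ (20 * (transferMatrix ^ m).trace) ^ 6 :=
            pow_le_pow_left₀ (trace_transferMatrix_pow_nonneg _)
              (trace_transferMatrix_pow_add_six_le m (by omega)) 6
        _ = 20 ^ 6 * (transferMatrix ^ m).trace ^ 6 := mul_pow _ _ _
        _ ≤ 20 ^ 6 * 20 ^ m := by gcongr; exact ih m (by omega) (by omega)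
        _ = 20 ^ (m + 6) := by ring

/-- The words read around a cycle of length `n`, with their two initial letters. -/
def cyclicSupportedWords (n : ℕ) : Finset (Bool × Bool × List Bool) :=
  Finset.univ.biUnion fun a => Finset.univ.biUnion fun b =>
    (supportedWords n a b a b).image fun l => (a, b, l)

theorem card_cyclicSupportedWords_le (n : ℕ) :
    ((cyclicSupportedWords n).card : ℤ) ≤ (transferMatrix ^ n).trace := by
  rw [Matrix.trace, Fintype.sum_prod_type]
  refine (Nat.cast_le.mpr Finset.card_biUnion_le).trans ?_
  rw [Nat.cast_sum]
  refine Finset.sum_le_sum fun a _ => (Nat.cast_le.mpr Finset.card_biUnion_le).trans ?_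
  rw [Nat.cast_sum]
  exact Finset.sum_le_sum fun b _ =>
    (Nat.cast_le.mpr Finset.card_image_le).trans (card_supportedWords_le n a b a b)

theorem card_cyclicSupportedWords_pow_le (n : ℕ) (hn : 2 ≤ n) :
    (cyclicSupportedWords n).card ^ 6 ≤ 20 ^ n := by
  have h := (pow_le_pow_left₀ (Nat.cast_nonneg _) (card_cyclicSupportedWords_le n) 6).trans
    (trace_transferMatrix_pow_le n hn)
  exact_mod_cast h

namespace SimpleGraph

variable {V : Type*} {G : SimpleGraph V}

theorem IsRegularOfDegree.exists_other_neighbor [G.LocallyFinite]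
    (hreg : G.IsRegularOfDegree 2) {u v : V} (h : G.Adj v u) :
    ∃ w, w ≠ u ∧ ∀ z, G.Adj v z ↔ z = u ∨ z = w := by
  classical
  obtain ⟨a, b, hab, hs⟩ := Finset.card_eq_two.mp (hreg v)
  have hz : ∀ z, G.Adj v z ↔ z = a ∨ z = b := fun z => by
    rw [← mem_neighborFinset, hs]; simp
  rcases (hz u).mp h with rfl | rfl
  · exact ⟨b, hab.symm, hz⟩
  · exact ⟨a, hab, fun z => (hz z).trans or_comm⟩

/-- A non-backtracking walk in a graph of degree two never traverses an edge backwards. -/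
theorem not_reversed_of_neighbors {x : ℕ → V}
    (hx : ∀ i w, G.Adj (x (i + 1)) w ↔ w = x i ∨ w = x (i + 2))
    (hne : ∀ i, x i ≠ x (i + 2)) (k i : ℕ) :
    ¬ (x i = x (i + k + 1) ∧ x (i + 1) = x (i + k)) := by
  induction k using Nat.strong_induction_on generalizing i with
  | _ k ih =>
    rintro ⟨h₁, h₂⟩
    match k with
    | 0 =>
      have h := (hx i (x i)).mpr (Or.inl rfl)
      exact G.irrefl (h₂ ▸ h)
    | 1 => exact hne i h₁
    | k + 2 =>
      refine ih k (by omega) (i + 1) ⟨h₂.trans (congrArg x (by omega)), ?_⟩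
      have h := (hx i (x (i + 2))).mpr (Or.inr rfl)
      rw [h₂, show i + (k + 2) = i + k + 1 + 1 by omega, hx] at h
      rcases h with h | h
      · exact h.trans (congrArg x (by omega))
      · exact absurd (h₁.trans (h.trans (congrArg x (by omega))).symm) (hne i)

theorem IsRegularOfDegree.exists_cyclic_enumeration [Fintype V] [DecidableRel G.Adj]
    (hreg : G.IsRegularOfDegree 2) (v : V) :
    ∃ (n : ℕ) (x : ℕ → V), 2 ≤ n ∧ x 0 = v ∧ (∀ i, x (i + n) = x i) ∧
      (∀ i w, G.Adj (x (i + 1)) w ↔ w = x i ∨ w = x (i + 2)) ∧ Set.InjOn x (Set.Iio n) := by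
  classical
  have hnext : ∀ d : G.Dart, ∃ e : G.Dart, e.fst = d.snd ∧ e.snd ≠ d.fst ∧
      ∀ z, G.Adj d.snd z ↔ z = d.fst ∨ z = e.snd := fun d => by
    obtain ⟨w, hw, hz⟩ := hreg.exists_other_neighbor d.adj.symm
    exact ⟨⟨(d.snd, w), (hz w).mpr (Or.inr rfl)⟩, rfl, hw, hz⟩
  choose next hfst hsnd hadj using hnext
  have hinj : Function.Injective next := fun d e h => by
    have h₁ : d.snd = e.snd := by rw [← hfst, h, hfst]
    have h₂ : d.fst = e.fst := by
      have h₃ := (hadj e d.fst).mp (h₁ ▸ d.adj.symm)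
      rw [← h] at h₃
      exact h₃.resolve_right (hsnd d).symm
    exact Dart.ext _ _ (Prod.ext h₂ h₁)
  obtain ⟨u, hu⟩ : ∃ u, G.Adj v u := by
    have h : 0 < G.degree v := by rw [hreg v]; norm_num
    exact (G.degree_pos_iff_exists_adj v).mp h
  let d : G.Dart := ⟨(v, u), hu⟩
  let n := Function.minimalPeriod next d
  have hn : 0 < n := Function.minimalPeriod_pos_of_mem_periodicPts (hinj.mem_periodicPts d)
  let x : ℕ → V := fun i => (next^[i] d).fst
  have hxs : ∀ i, (next^[i] d).snd = x (i + 1) := fun i => by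
    simp only [x, Function.iterate_succ_apply', hfst]
  have hper : ∀ i, x (i + n) = x i := fun i => by
    simp only [x, n, Function.iterate_add_minimalPeriod_eq]
  have hx : ∀ i w, G.Adj (x (i + 1)) w ↔ w = x i ∨ w = x (i + 2) := fun i w => by
    have h := hadj (next^[i] d) w
    rwa [← Function.iterate_succ_apply' next, hxs, hxs] at h
  have hne : ∀ i, x i ≠ x (i + 2) := fun i h => by
    have h' := hsnd (next^[i] d)
    rw [← Function.iterate_succ_apply' next, hxs] at h'
    exact h' h.symm
  have hadjx : ∀ i, G.Adj (x i) (x (i + 1)) := fun i => ((hx i _).mpr (Or.inl rfl)).symm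
  have hlt : ∀ i j, i < j → j < n → x i ≠ x j := fun i j hij hj h => by
    have h' := (hx (i + (n - 1)) (x (j + 1))).mp (by
      rw [show i + (n - 1) + 1 = i + n by omega, hper, h]; exact hadjx j)
    rcases h' with h' | h'
    · refine not_reversed_of_neighbors hx hne (j - i + 1) (i + (n - 1)) ⟨?_, ?_⟩
      · rw [show i + (n - 1) + (j - i + 1) + 1 = j + 1 + n by omega, hper, h']
      · rw [show i + (n - 1) + (j - i + 1) = j + n by omega, hper, ← h,
          show i + (n - 1) + 1 = i + n by omega, hper]
    · rw [show i + (n - 1) + 2 = i + 1 + n by omega, hper] at h'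
      refine hij.ne (Function.iterate_injOn_Iio_minimalPeriod (f := next) (x := d)
        (Set.mem_Iio.mpr (hij.trans hj)) (Set.mem_Iio.mpr hj) ?_)
      exact Dart.ext _ _ (Prod.ext h ((hxs i).trans (h'.symm.trans (hxs j).symm)))
  refine ⟨n, x, ?_, rfl, hper, hx, fun i hi j hj h => ?_⟩
  · by_contra hn2
    have h1 : n = 1 := by omega
    have h := hper 0
    rw [h1] at h
    exact (hadjx 0).ne h.symm
  · rcases lt_trichotomy i j with hij | hij | hij
    · exact absurd h (hlt i j hij hj)
    · exact hij
    · exact absurd h.symm (hlt j i hij hi)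

/-- The two-colorings for which every vertex of `S` has a neighbor of its own color, normalized
outside `S`. -/
def supportedColorings (G : SimpleGraph V) (S : Finset V) : Set (V → Bool) :=
  {φ | (∀ v ∈ S, ∃ w, G.Adj v w ∧ φ v = φ w) ∧ ∀ v ∉ S, φ v = false}

theorem IsRegularOfDegree.ncard_supportedColorings_pow_le [Fintype V] [DecidableRel G.Adj]
    (hreg : G.IsRegularOfDegree 2) (S : Finset V) (hS : ∀ v ∈ S, ∀ w, G.Adj v w → w ∈ S) :
    (G.supportedColorings S).ncard ^ 6 ≤ 20 ^ S.card := by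
  classical
  induction S using Finset.strongInduction with
  | _ S ih =>
  rcases S.eq_empty_or_nonempty with rfl | ⟨v, hv⟩
  · have h : (G.supportedColorings ∅).ncard ≤ 1 :=
      (Set.ncard_le_one (Set.toFinite _)).mpr fun φ hφ ψ hψ => funext fun v => by
        rw [hφ.2 v (by simp), hψ.2 v (by simp)]
    simpa using pow_le_pow_left₀ (Nat.zero_le _) h 6
  obtain ⟨n, x, hn, hx0, hper, hx, hinj⟩ := hreg.exists_cyclic_enumeration v
  let O := (Finset.range n).image x
  have hmod : ∀ i, x (i % n) = x i := fun i => Function.Periodic.map_mod_nat hper i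
  have hxO : ∀ i, x i ∈ O := fun i => Finset.mem_image.mpr
    ⟨i % n, Finset.mem_range.mpr (Nat.mod_lt _ (by omega)), hmod i⟩
  have hOcard : O.card = n := by
    rw [Finset.card_image_of_injOn (by simpa using hinj), Finset.card_range]
  have hxS : ∀ i, x i ∈ S := fun i => by
    induction i with
    | zero => rwa [hx0]
    | succ i hi => exact hS _ hi _ ((hx i _).mpr (Or.inl rfl)).symm
  have hOS : O ⊆ S := Finset.image_subset_iff.mpr fun i _ => hxS i
  have hclosed : ∀ v ∈ O, ∀ w, G.Adj v w → w ∈ O := fun v hv w hw => by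
    obtain ⟨i, -, rfl⟩ := Finset.mem_image.mp hv
    rw [← hper, show i + n = i + (n - 1) + 1 by omega, hx] at hw
    rcases hw with rfl | rfl <;> exact hxO _
  have hrest : (G.supportedColorings (S \ O)).ncard ^ 6 ≤ 20 ^ (S \ O).card := by
    refine ih _ (Finset.sdiff_ssubset hOS ⟨x 0, hxO 0⟩) fun v hv w hw => ?_
    rw [Finset.mem_sdiff] at hv ⊢
    exact ⟨hS v hv.1 w hw, fun h => hv.2 (hclosed w h v hw.symm)⟩
  let F : (V → Bool) → (V → Bool) × (Bool × Bool × List Bool) := fun φ =>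
    (fun v => if v ∈ O then false else φ v,
      φ (x 0), φ (x 1), (List.range n).map fun i => φ (x (i + 2)))
  have hmaps : ∀ φ ∈ G.supportedColorings S,
      F φ ∈ G.supportedColorings (S \ O) ×ˢ (cyclicSupportedWords n : Set _) := by
    rintro φ ⟨hφ, hφ'⟩
    refine ⟨⟨fun v hv => ?_, fun v hv => ?_⟩, ?_⟩
    · rw [Finset.mem_sdiff] at hv
      obtain ⟨w, hw, hvw⟩ := hφ v hv.1
      have hwO : w ∉ O := fun h => hv.2 (hclosed w h v hw.symm)
      exact ⟨w, hw, by simpa [F, hv.2, hwO] using hvw⟩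
    · by_cases hvO : v ∈ O
      · simp [F, hvO]
      · have hvS : v ∉ S := fun h => hv (Finset.mem_sdiff.mpr ⟨h, hvO⟩)
        simpa [F, hvO] using hφ' v hvS
    · have h := map_range_mem_supportedWords n (fun i => φ (x i)) fun i => by
        obtain ⟨w, hw, hvw⟩ := hφ _ (hxS (i + 1))
        rcases (hx i w).mp hw with rfl | rfl
        · exact Or.inl hvw
        · exact Or.inr hvw
      have h0 : x n = x 0 := by simpa using hper 0
      have h1 : x (n + 1) = x 1 := by rw [add_comm]; exact hper 1
      rw [h0, h1] at h
      exact Finset.mem_biUnion.mpr ⟨_, Finset.mem_univ _,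
        Finset.mem_biUnion.mpr ⟨_, Finset.mem_univ _, Finset.mem_image_of_mem _ h⟩⟩
  have hFinj : Set.InjOn F (G.supportedColorings S) := fun φ _ ψ _ h => by
    funext v
    by_cases hv : v ∈ O
    · obtain ⟨i, -, rfl⟩ := Finset.mem_image.mp hv
      have hl : (List.range n).map (fun i => φ (x (i + 2))) =
        (List.range n).map (fun i => ψ (x (i + 2))) := congrArg (fun p => p.2.2.2) h
      have hi := List.map_inj_left.mp hl ((i + (2 * n - 2)) % n)
        (List.mem_range.mpr (Nat.mod_lt _ (by omega)))
      have hxi : x ((i + (2 * n - 2)) % n + 2) = x i := by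
        rw [← hmod, Nat.mod_add_mod, hmod, show i + (2 * n - 2) + 2 = i + n + n by omega, hper,
          hper]
      rwa [hxi] at hi
    · have h' := congrFun (congrArg Prod.fst h) v
      simpa [F, hv] using h'
  have hle := Set.ncard_le_ncard_of_injOn F hmaps hFinj (Set.toFinite _)
  rw [Set.ncard_prod, Set.ncard_coe_finset] at hle
  calc (G.supportedColorings S).ncard ^ 6
      ≤ ((G.supportedColorings (S \ O)).ncard * (cyclicSupportedWords n).card) ^ 6 := by gcongr
    _ = (G.supportedColorings (S \ O)).ncard ^ 6 * (cyclicSupportedWords n).card ^ 6 :=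
        mul_pow _ _ _
    _ ≤ 20 ^ (S \ O).card * 20 ^ n :=
        Nat.mul_le_mul hrest (card_cyclicSupportedWords_pow_le n hn)
    _ = 20 ^ S.card := by
        rw [← pow_add, ← hOcard, Finset.card_sdiff_add_card_eq_card hOS]

end SimpleGraph

theorem ncard_cycleGraph_six_colorings :
    {φ : Fin 6 → Bool | ∀ v, ∃ w, (SimpleGraph.cycleGraph 6).Adj v w ∧ φ v = φ w}.ncard = 20 := by
  rw [Set.ncard_eq_toFinset_card', Set.toFinset_ofPred]
  decide +kernel

/-- If `G` is a `2`-regular graph on `n` vertices, then the number of existence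
homomorphisms from `G` to `E_2` (equivalently, two-colorings in which every vertex has a
neighbor of the same color) is at most `c_6^(n/6)`, where `c_6` is the corresponding count
for the six-cycle. -/
theorem stmt17 {V : Type*} [Fintype V] (G : SimpleGraph V) [DecidableRel G.Adj] (hreg : G.IsRegularOfDegree 2) :
    ({φ : V → Bool | ∀ v : V, ∃ w : V, G.Adj v w ∧ φ v = φ w}.ncard : ℝ) ≤
      ({φ : Fin 6 → Bool | ∀ v, ∃ w, (SimpleGraph.cycleGraph 6).Adj v w ∧
        φ v = φ w}.ncard : ℝ) ^ ((Fintype.card V : ℝ) / 6) := by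
  have h := hreg.ncard_supportedColorings_pow_le Finset.univ fun _ _ w _ => Finset.mem_univ w
  simp only [SimpleGraph.supportedColorings, Finset.mem_univ, not_true_eq_false,
    forall_true_left, false_imp_iff, implies_true, and_true, Finset.card_univ] at h
  rw [ncard_cycleGraph_six_colorings]
  refine le_of_pow_le_pow_left₀ (n := 6) (by norm_num) (by positivity) ?_
  rw [← Real.rpow_natCast _ 6, ← Real.rpow_natCast _ 6, ← Real.rpow_mul (by positivity)]
  rw [show (Fintype.card V : ℝ) / 6 * ((6 : ℕ) : ℝ) = Fintype.card V by push_cast; ring,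
    Real.rpow_natCast, Real.rpow_natCast]
  exact_mod_cast h
end
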